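/- Let p > 3 be a prime with p ≡ 3 (mod 4). Then the determinant of the (p-1)/2 × (p-1)/2 matrix [1 + ((j-i)/p)]_{1 ≤ i,j ≤ (p-1)/2} equals 1. -/

import Mathlib

section CauchyDet

open Matrix Finset

variable {K : Type*} [Field K] {n : ℕ}

lemma lagrangeBasis_vecMul_vandermonde {v : Fin n → K} (hv : Function.Injective v) (x : K) :
    (fun j => (Lagrange.basis univ v j).eval x) ᵥ* vandermonde v =
      fun k : Fin n => x ^ (k : ℕ) := by
  ext k
  have hdeg : (Polynomial.X ^ (k : ℕ) : Polynomial K).degree < #(univ : Finset (Fin n)) := by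
    rw [Polynomial.degree_X_pow, card_univ, Fintype.card_fin]
    exact_mod_cast k.2
  have h := congrArg (Polynomial.eval x) (Lagrange.eq_interpolate hv.injOn hdeg)
  simp only [Lagrange.interpolate_apply, Polynomial.eval_finsetSum, Polynomial.eval_mul,
    Polynomial.eval_C, Polynomial.eval_pow, Polynomial.eval_X] at h
  rw [h]
  simp only [vecMul, dotProduct, vandermonde_apply]
  exact sum_congr rfl fun j _ => mul_comm _ _

lemma lagrangeBasis_mul_vandermonde {v : Fin n → K} (hv : Function.Injective v) (x : Fin n → K) :
    (of fun i j => (Lagrange.basis univ v j).eval (x i)) * vandermonde v = vandermonde x := by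
  ext i k
  exact congrFun (lagrangeBasis_vecMul_vandermonde hv (x i)) k

lemma prod_prod_compl_eq_prod_prod_Ioi (f : Fin n → Fin n → K) :
    ∏ i, ∏ j ∈ {i}ᶜ, f i j = ∏ i, ∏ j ∈ Ioi i, f i j * f j i :=
  (prod_prod_Ioi_mul_eq_prod_prod_off_diag fun i j => f j i).symm

lemma prod_prod_eq_prod_mul_prod_prod_compl (f : Fin n → Fin n → K) :
    ∏ i, ∏ j, f i j = (∏ i, f i i) * ∏ i, ∏ j ∈ {i}ᶜ, f i j := by
  rw [← prod_mul_distrib]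
  refine prod_congr rfl fun i _ => ?_
  rw [← Fintype.prod_eq_mul_prod_compl]

lemma nodalWeight_univ_eq (v : Fin n → K) (i : Fin n) :
    Lagrange.nodalWeight univ v i = ∏ j ∈ {i}ᶜ, (v i - v j)⁻¹ := by
  rw [Lagrange.nodalWeight, compl_eq_univ_sdiff, sdiff_singleton_eq_erase]

/-- The Cauchy determinant. -/
lemma det_inv_sub {x z : Fin n → K} (hz : Function.Injective z) (hxz : ∀ i j, x i ≠ z j) :
    (of fun i j => (x i - z j)⁻¹).det * ∏ i, ∏ j, (x i - z j) =
      ∏ i, ∏ j ∈ Ioi i, (x j - x i) * (z i - z j) := by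
  have h := congrArg det (lagrangeBasis_mul_vandermonde hz x)
  have hL : (of fun i j => (Lagrange.basis univ z j).eval (x i)) =
      of fun i j => (∏ k, (x i - z k)) *
        (of fun i j => Lagrange.nodalWeight univ z j * (of fun i j => (x i - z j)⁻¹) i j) i j := by
    ext i j
    simp only [of_apply]
    rw [Lagrange.eval_basis_not_at_node (mem_univ j) (hxz i j), Lagrange.eval_nodal]
  rw [det_mul, hL, det_mul_column, det_mul_row, det_vandermonde, det_vandermonde] at h
  simp only [nodalWeight_univ_eq] at h
  rw [prod_prod_compl_eq_prod_prod_Ioi] at h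
  have hne : ∀ i, ∀ j ∈ Ioi i, z i - z j ≠ 0 := fun i j hj =>
    sub_ne_zero.2 (hz.ne (mem_Ioi.1 hj).ne)
  have e : (∏ i, ∏ j ∈ Ioi i, (z i - z j)⁻¹ * (z j - z i)⁻¹) * (∏ i, ∏ j ∈ Ioi i, (z j - z i)) *
      (∏ i, ∏ j ∈ Ioi i, (z i - z j)) = 1 := by
    simp only [← prod_mul_distrib]
    refine prod_eq_one fun i _ => prod_eq_one fun j hj => ?_
    have h1 := hne i j hj
    have h2 : z j - z i ≠ 0 := by rw [← neg_sub]; exact neg_ne_zero.2 h1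
    field_simp
  simp only [prod_mul_distrib] at h e ⊢
  rw [← h]
  linear_combination (-(of fun i j => (x i - z j)⁻¹).det * ∏ i, ∏ j, (x i - z j)) * e

/-- The determinant of a rank-one perturbation by a constant matrix is affine in the constant. -/
lemma det_const_add (S : Matrix (Fin n) (Fin n) K) (κ : K) :
    (of fun i j => κ + S i j).det = S.det + κ * ((of fun i j => 1 + S i j).det - S.det) := by
  obtain _ | n := n
  · simp
  have key : ∀ c : K, (of fun i j => c + S i j).det =
      c * ((of fun i j => S i j - S 0 j).updateRow 0 fun _ => 1).det + S.det := by
    intro c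
    have h1 : (of fun i j => c + S i j).det =
        ((of fun i j => S i j - S 0 j).updateRow 0 (c • (fun _ => 1) + S 0)).det := by
      refine det_eq_of_forall_row_eq_smul_add_const (fun i => if i = 0 then 0 else 1) 0 (by simp) ?_
      intro i j
      by_cases hi : i = 0
      · subst hi; simp
      · simp [hi, updateRow_apply, add_comm]
    have h2 : S.det = ((of fun i j => S i j - S 0 j).updateRow 0 (S 0)).det := by
      refine det_eq_of_forall_row_eq_smul_add_const (fun i => if i = 0 then 0 else 1) 0 (by simp) ?_
      intro i j
      by_cases hi : i = 0
      · subst hi; simp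
      · simp [hi, updateRow_apply]
    rw [h1, det_updateRow_add, det_updateRow_smul, ← h2]
  rw [key κ, key 1]
  ring

lemma det_const_add_of_skew [CharZero K] (hn : Odd n) {S : Matrix (Fin n) (Fin n) K}
    (hS : Sᵀ = -S) (κ : K) :
    (of fun i j => κ + S i j).det = κ * (of fun i j => 1 + S i j).det := by
  have h0 : S.det = 0 := by
    have h := det_transpose S
    rw [hS, det_neg, Fintype.card_fin, hn.neg_one_pow] at h
    have : (2 : K) * S.det = 0 := by linear_combination -h
    simpa using this
  rw [det_const_add, h0]
  ring

/-- A determinantal form of the Schur Pfaffian. -/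
lemma det_const_add_schur [CharZero K] (hn : Odd n) {y : Fin n → K} (hy : Function.Injective y)
    (h0 : ∀ i, y i ≠ 0) (h1 : ∀ i j, 1 - y i * y j ≠ 0) (κ : K) :
    (of fun i j => κ + (y i - y j) / (1 - y i * y j)).det =
      κ * ∏ i, ∏ j ∈ Ioi i, ((y i - y j) / (1 - y i * y j)) ^ 2 := by
  have hskew := det_const_add_of_skew (κ := κ) hn
    (S := of fun i j => (y i - y j) / (1 - y i * y j)) (by
      ext i j
      simp only [transpose_apply, of_apply, Matrix.neg_apply]
      rw [mul_comm (y j), ← neg_sub (y i), neg_div])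
  simp only [of_apply] at hskew
  rw [hskew]
  congr 1
  have hinj : Function.Injective fun i => (y i)⁻¹ := fun i j h => hy (inv_injective h)
  have hd : ∀ i j, y i - (y j)⁻¹ ≠ 0 := fun i j h => h1 i j (by
    have := h0 j
    field_simp at h
    linear_combination -h)
  have hc := det_inv_sub hinj fun i j => sub_ne_zero.1 (hd i j)
  have hM : (of fun i j => 1 + (y i - y j) / (1 - y i * y j)) =
      of fun i j => (1 + y i) * (of fun i j => (-(1 - y j) * (y j)⁻¹) *
        (of fun i j => (y i - (y j)⁻¹)⁻¹) i j) i j := by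
    ext i j
    simp only [of_apply]
    have a := h1 i j
    have b := h0 j
    have c := hd i j
    have d : y i - (y j)⁻¹ = -(1 - y i * y j) * (y j)⁻¹ := by field_simp; ring
    rw [d]
    field_simp
    ring
  rw [hM, det_mul_column, det_mul_row]
  rw [prod_prod_eq_prod_mul_prod_prod_compl, prod_prod_compl_eq_prod_prod_Ioi] at hc
  have hA : (∏ i, (1 + y i)) * (∏ i, -(1 - y i) * (y i)⁻¹) = ∏ i, (y i - (y i)⁻¹) := by
    rw [← prod_mul_distrib]
    refine prod_congr rfl fun i _ => ?_
    have := h0 i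
    field_simp
    ring
  have hB : (∏ i, ∏ j ∈ Ioi i, (y j - y i) * ((y i)⁻¹ - (y j)⁻¹)) =
      (∏ i, ∏ j ∈ Ioi i, ((y i - y j) / (1 - y i * y j)) ^ 2) *
        ∏ i, ∏ j ∈ Ioi i, (y i - (y j)⁻¹) * (y j - (y i)⁻¹) := by
    simp only [← prod_mul_distrib]
    refine prod_congr rfl fun i _ => prod_congr rfl fun j _ => ?_
    have a := h1 i j
    have b := h0 j
    have c := h0 i
    have h : (y i - (y j)⁻¹) * (y j - (y i)⁻¹) = (1 - y i * y j) ^ 2 * ((y i)⁻¹ * (y j)⁻¹) := by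
      field_simp
      ring
    rw [h, div_pow, ← mul_assoc, div_mul_cancel₀ _ (pow_ne_zero 2 a)]
    field_simp
    ring
  have hne : (∏ i, ∏ j ∈ Ioi i, (y i - (y j)⁻¹) * (y j - (y i)⁻¹)) ≠ 0 :=
    prod_ne_zero_iff.2 fun i _ => prod_ne_zero_iff.2 fun j _ => mul_ne_zero (hd i j) (hd j i)
  rw [hB] at hc
  apply mul_right_cancel₀ hne
  rw [← hc, ← hA]
  ring

end CauchyDet

section QuadraticResidues

open Finset

variable {p : ℕ} [Fact p.Prime]

/-- The nonzero quadratic residues modulo `p`. -/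
def quadResidues (p : ℕ) [Fact p.Prime] : Finset (ZMod p) :=
  {a | quadraticChar (ZMod p) a = 1}

lemma mem_quadResidues {a : ZMod p} : a ∈ quadResidues p ↔ quadraticChar (ZMod p) a = 1 := by
  simp [quadResidues]

lemma ne_zero_of_mem_quadResidues {a : ZMod p} (ha : a ∈ quadResidues p) : a ≠ 0 := by
  rintro rfl
  simp [mem_quadResidues] at ha

lemma mul_mem_quadResidues {a b : ZMod p} (ha : a ∈ quadResidues p) (hb : b ∈ quadResidues p) :
    a * b ∈ quadResidues p := by
  rw [mem_quadResidues] at *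
  rw [map_mul, ha, hb, one_mul]

lemma inv_mem_quadResidues {a : ZMod p} (ha : a ∈ quadResidues p) : a⁻¹ ∈ quadResidues p := by
  have h := congrArg (quadraticChar (ZMod p)) (mul_inv_cancel₀ (ne_zero_of_mem_quadResidues ha))
  rw [mem_quadResidues] at *
  rwa [map_mul, ha, one_mul, map_one] at h

lemma one_mem_quadResidues : (1 : ZMod p) ∈ quadResidues p := by
  simp [mem_quadResidues]

@[to_additive]
lemma prod_quadResidues_dilate {M : Type*} [CommMonoid M] {m : ZMod p} (hm : m ∈ quadResidues p)
    (f : ZMod p → M) : ∏ r ∈ quadResidues p, f (m * r) = ∏ r ∈ quadResidues p, f r := by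
  have hm0 := ne_zero_of_mem_quadResidues hm
  refine prod_nbij' (m * ·) (m⁻¹ * ·) (fun r hr => mul_mem_quadResidues hm hr)
    (fun r hr => mul_mem_quadResidues (inv_mem_quadResidues hm) hr) ?_ ?_ fun _ _ => rfl
  · intro r _
    exact inv_mul_cancel_left₀ hm0 r
  · intro r _
    exact mul_inv_cancel_left₀ hm0 r

lemma prod_prod_erase_quadResidues_dilate {M : Type*} [CommMonoid M] {m : ZMod p}
    (hm : m ∈ quadResidues p) (f : ZMod p → ZMod p → M) :
    ∏ r ∈ quadResidues p, ∏ s ∈ (quadResidues p).erase r, f (m * r) (m * s) =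
      ∏ r ∈ quadResidues p, ∏ s ∈ (quadResidues p).erase r, f r s := by
  rw [← prod_quadResidues_dilate hm fun r => ∏ s ∈ (quadResidues p).erase r, f r s]
  have hm0 := ne_zero_of_mem_quadResidues hm
  refine prod_congr rfl fun r _ => ?_
  refine prod_nbij' (m * ·) (m⁻¹ * ·) ?_ ?_ ?_ ?_ fun _ _ => rfl
  · intro s hs
    rw [mem_erase] at *
    exact ⟨fun h => hs.1 (mul_left_cancel₀ hm0 h), mul_mem_quadResidues hm hs.2⟩
  · intro s hs
    rw [mem_erase] at *
    refine ⟨fun h => hs.1 ?_, mul_mem_quadResidues (inv_mem_quadResidues hm) hs.2⟩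
    rw [← h, mul_inv_cancel_left₀ hm0]
  · intro s _
    exact inv_mul_cancel_left₀ hm0 s
  · intro s _
    exact mul_inv_cancel_left₀ hm0 s

lemma sum_quadResidues (hp3 : 3 < p) : ∑ r ∈ quadResidues p, r = 0 := by
  have cast_ne : ∀ k : ℕ, 0 < k → k < p → (k : ZMod p) ≠ 0 := fun k h0 hk h =>
    (Nat.not_dvd_of_pos_of_lt h0 hk) ((ZMod.natCast_eq_zero_iff k p).1 h)
  have h2 : (2 : ZMod p) ≠ 0 := mod_cast cast_ne 2 (by omega) (by omega)
  have h3 : (3 : ZMod p) ≠ 0 := mod_cast cast_ne 3 (by omega) hp3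
  have h4 : (4 : ZMod p) ∈ quadResidues p := by
    rw [mem_quadResidues, show (4 : ZMod p) = 2 ^ 2 by norm_num]
    exact quadraticChar_sq_one' h2
  have h := sum_quadResidues_dilate h4 fun r => r
  rw [← mul_sum] at h
  have : (3 : ZMod p) * ∑ r ∈ quadResidues p, r = 0 := by linear_combination h
  exact (mul_eq_zero.1 this).resolve_left h3

lemma quadraticChar_neg_of_mod_four (hp : p % 4 = 3) (a : ZMod p) :
    quadraticChar (ZMod p) (-a) = -quadraticChar (ZMod p) a := by
  have h : quadraticChar (ZMod p) (-1) = -1 := by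
    rw [quadraticChar_neg_one_iff_not_isSquare, FiniteField.isSquare_neg_one_iff, ZMod.card]
    simpa using hp
  rw [← neg_one_mul, map_mul, h, neg_one_mul]

lemma neg_mem_quadResidues_iff (hp : p % 4 = 3) {a : ZMod p} :
    -a ∈ quadResidues p ↔ quadraticChar (ZMod p) a = -1 := by
  rw [mem_quadResidues, quadraticChar_neg_of_mod_four hp, neg_eq_iff_eq_neg]

@[to_additive]
lemma prod_compl_zero_eq_prod_quadResidues (hp : p % 4 = 3) {M : Type*} [CommMonoid M]
    (f : ZMod p → M) :
    ∏ a ∈ ({0}ᶜ : Finset (ZMod p)), f a = ∏ r ∈ quadResidues p, f r * f (-r) := by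
  rw [prod_mul_distrib,
    ← prod_filter_mul_prod_filter_not ({0}ᶜ : Finset (ZMod p)) (· ∈ quadResidues p)]
  congr 1
  · refine prod_congr ?_ fun _ _ => rfl
    ext a
    simpa using ne_zero_of_mem_quadResidues
  · refine prod_nbij' (- ·) (- ·) ?_ ?_ (fun _ _ => neg_neg _) (fun _ _ => neg_neg _)
      fun _ _ => by rw [neg_neg]
    · intro a ha
      simp only [mem_filter, mem_compl, mem_singleton, mem_quadResidues] at ha
      exact (neg_mem_quadResidues_iff hp).2 ((quadraticChar_dichotomy ha.1).resolve_left ha.2)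
    · intro a ha
      have h0 := ne_zero_of_mem_quadResidues ha
      rw [mem_filter, mem_compl, mem_singleton, neg_mem_quadResidues_iff hp, mem_quadResidues.1 ha]
      exact ⟨neg_ne_zero.2 h0, by norm_num⟩

lemma card_quadResidues (hp : p % 4 = 3) : #(quadResidues p) = (p - 1) / 2 := by
  have h := sum_compl_zero_eq_sum_quadResidues hp (p := p) fun _ => 1
  simp only [sum_const, smul_eq_mul, mul_one, card_compl, card_singleton, ZMod.card] at h
  omega

lemma odd_card_quadResidues (hp : p % 4 = 3) : Odd #(quadResidues p) := by
  rw [card_quadResidues hp, Nat.odd_iff]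
  omega

lemma prod_addChar_quadResidues (hp3 : 3 < p) (ψ : AddChar (ZMod p) ℂ) :
    ∏ r ∈ quadResidues p, ψ r = 1 := by
  have h : ψ (∑ r ∈ quadResidues p, r) = ∏ r ∈ quadResidues p, ψ r := by
    exact map_prod ψ.toMonoidHom (fun r : ZMod p => Multiplicative.ofAdd r) (quadResidues p)
  rw [← h, sum_quadResidues hp3, AddChar.map_zero_eq_one]

lemma prod_one_sub_addChar_mul (hp3 : 3 < p) (hp : p % 4 = 3) (ψ : AddChar (ZMod p) ℂ) {m : ZMod p}
    (hm : m ≠ 0) :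
    ∏ r ∈ quadResidues p, (1 - ψ (m * r)) =
      quadraticChar (ZMod p) m * ∏ r ∈ quadResidues p, (1 - ψ r) := by
  obtain h | h := quadraticChar_dichotomy hm
  · rw [prod_quadResidues_dilate (mem_quadResidues.2 h) fun r => 1 - ψ r, h, Int.cast_one, one_mul]
  · have h' := prod_quadResidues_dilate ((neg_mem_quadResidues_iff hp).2 h) fun r => 1 - ψ (-r)
    simp only [neg_mul, neg_neg] at h'
    have hneg : ∀ r, 1 - ψ r = -(ψ r * (1 - ψ (-r))) := fun r => by
      rw [mul_sub, ← AddChar.map_add_eq_mul, add_neg_cancel, AddChar.map_zero_eq_one]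
      ring
    have e : ∏ r ∈ quadResidues p, (1 - ψ r) = -∏ r ∈ quadResidues p, (1 - ψ (-r)) := by
      rw [prod_congr rfl fun r _ => hneg r, prod_neg, prod_mul_distrib,
        prod_addChar_quadResidues hp3, (odd_card_quadResidues hp).neg_one_pow]
      ring
    rw [h', h, e]
    push_cast
    ring

lemma prod_one_sub_addChar {ψ : AddChar (ZMod p) ℂ} (hψ : Function.Injective ψ) :
    ∏ a ∈ ({0}ᶜ : Finset (ZMod p)), (1 - ψ a) = (p : ℂ) := by
  have hpp := (Fact.out : p.Prime)
  have hprim : IsPrimitiveRoot (ψ 1) (p - 1 + 1) := by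
    rw [Nat.sub_add_cancel hpp.one_le, IsPrimitiveRoot.iff_orderOf]
    refine orderOf_eq_prime ?_ fun h => one_ne_zero (hψ (h.trans ψ.map_zero_eq_one.symm))
    rw [← AddChar.map_nsmul_eq_pow, nsmul_one, ZMod.natCast_self, AddChar.map_zero_eq_one]
  have h := hprim.prod_one_sub_pow_eq_order
  rw [Nat.cast_sub hpp.one_le] at h
  simp only [Nat.cast_one, sub_add_cancel] at h
  rw [← h]
  refine prod_nbij' (fun a => a.val - 1) (fun k => ((k + 1 : ℕ) : ZMod p)) ?_ ?_ ?_ ?_ ?_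
  · intro a ha
    have := a.val_lt
    have : a.val ≠ 0 := by simpa [ZMod.val_eq_zero] using ha
    rw [mem_range]
    omega
  · intro k hk
    rw [mem_range] at hk
    rw [mem_compl, mem_singleton, ZMod.natCast_eq_zero_iff]
    exact Nat.not_dvd_of_pos_of_lt (by omega) (by omega)
  · intro a ha
    have : a.val ≠ 0 := by simpa [ZMod.val_eq_zero] using ha
    rw [Nat.sub_add_cancel (by omega), ZMod.natCast_zmod_val]
  · intro k hk
    rw [mem_range] at hk
    rw [ZMod.val_cast_of_lt (by omega)]
    omega
  · intro a ha
    have : a.val ≠ 0 := by simpa [ZMod.val_eq_zero] using ha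
    rw [Nat.sub_add_cancel (by omega), ← AddChar.map_nsmul_eq_pow, nsmul_one, ZMod.natCast_zmod_val]

lemma sq_prod_one_sub_addChar (hp3 : 3 < p) (hp : p % 4 = 3) {ψ : AddChar (ZMod p) ℂ}
    (hψ : Function.Injective ψ) :
    (∏ r ∈ quadResidues p, (1 - ψ r)) ^ 2 = -(p : ℂ) := by
  have h := prod_compl_zero_eq_prod_quadResidues hp (p := p) fun a => 1 - ψ a
  have h' := prod_one_sub_addChar_mul hp3 hp ψ (m := -1) (by simp)
  rw [quadraticChar_neg_of_mod_four hp, map_one] at h'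
  simp only [neg_one_mul] at h'
  rw [prod_one_sub_addChar hψ, prod_mul_distrib, h'] at h
  rw [h]
  push_cast
  ring

lemma one_add_ne_zero_of_mem_quadResidues (hp : p % 4 = 3) {t : ZMod p} (ht : t ∈ quadResidues p) :
    1 + t ≠ 0 := by
  intro h
  have := (neg_mem_quadResidues_iff hp (a := 1)).1 (by rwa [neg_eq_of_add_eq_zero_right h])
  rw [map_one] at this
  norm_num at this

lemma prod_quadraticChar_one_add (hp : p % 4 = 3) :
    ∏ t ∈ (quadResidues p).erase 1, quadraticChar (ZMod p) (1 + t) = 1 := by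
  have hadd : ∀ t ∈ (quadResidues p).erase 1, 1 + t ≠ 0 := fun t ht =>
    one_add_ne_zero_of_mem_quadResidues hp (mem_erase.1 ht).2
  refine prod_involution (fun t _ => t⁻¹) ?_ ?_ ?_ fun _ _ => inv_inv _
  · intro t ht
    have h0 := ne_zero_of_mem_quadResidues (mem_erase.1 ht).2
    have e : 1 + t⁻¹ = t⁻¹ * (1 + t) := by field_simp; ring
    rw [e, map_mul, mem_quadResidues.1 (inv_mem_quadResidues (mem_erase.1 ht).2), one_mul, ← sq]
    exact quadraticChar_sq_one (hadd t ht)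
  · intro t ht _ h
    have h0 := ne_zero_of_mem_quadResidues (mem_erase.1 ht).2
    rcases mul_self_eq_one_iff.1 ((congrArg (t * ·) h).symm.trans (mul_inv_cancel₀ h0)) with h | h
    · exact (mem_erase.1 ht).1 h
    · exact hadd t ht (by rw [h]; ring)
  · intro t ht
    rw [mem_erase] at *
    exact ⟨fun h => ht.1 (inv_eq_one.1 h), inv_mem_quadResidues ht.2⟩

lemma prod_prod_one_sub_addChar_add (hp3 : 3 < p) (hp : p % 4 = 3) (ψ : AddChar (ZMod p) ℂ) :
    ∏ r ∈ quadResidues p, ∏ s ∈ (quadResidues p).erase r, (1 - ψ (r + s)) =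
      (∏ r ∈ quadResidues p, (1 - ψ r)) ^ (#(quadResidues p) - 1) := by
  have h : ∀ r ∈ quadResidues p, ∏ s ∈ (quadResidues p).erase r, (1 - ψ (r + s)) =
      ∏ t ∈ (quadResidues p).erase 1, (1 - ψ ((1 + t) * r)) := by
    intro r hr
    have h0 := ne_zero_of_mem_quadResidues hr
    refine prod_nbij' (· * r⁻¹) (· * r) ?_ ?_ ?_ ?_ ?_
    · intro s hs
      rw [mem_erase] at *
      refine ⟨fun h => hs.1 ?_, mul_mem_quadResidues hs.2 (inv_mem_quadResidues hr)⟩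
      field_simp at h
      exact h
    · intro t ht
      rw [mem_erase] at *
      refine ⟨fun h => ht.1 ?_, mul_mem_quadResidues ht.2 hr⟩
      exact mul_right_cancel₀ h0 (by rw [h, one_mul])
    · intro s _
      exact inv_mul_cancel_right₀ h0 s
    · intro s _
      exact mul_inv_cancel_right₀ h0 s
    · intro s _
      rw [add_mul, one_mul, inv_mul_cancel_right₀ h0]
  have hadd : ∀ t ∈ (quadResidues p).erase 1, 1 + t ≠ 0 := fun t ht =>
    one_add_ne_zero_of_mem_quadResidues hp (mem_erase.1 ht).2
  rw [prod_congr rfl h, prod_comm,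
    prod_congr rfl fun t ht => prod_one_sub_addChar_mul hp3 hp ψ (hadd t ht), prod_mul_distrib,
    prod_const, card_erase_of_mem one_mem_quadResidues, ← Int.cast_prod,
    prod_quadraticChar_one_add hp, Int.cast_one, one_mul]

lemma prod_prod_addChar_add (hp3 : 3 < p) (hp : p % 4 = 3) {ψ : AddChar (ZMod p) ℂ}
    (hψ : Function.Injective ψ) :
    ∏ r ∈ quadResidues p, ∏ s ∈ (quadResidues p).erase r, (ψ r + ψ s) = 1 := by
  set D := ∏ r ∈ quadResidues p, ∏ s ∈ (quadResidues p).erase r, (ψ r - ψ s) with hD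
  have hD0 : D ≠ 0 := prod_ne_zero_iff.2 fun r _ => prod_ne_zero_iff.2 fun s hs =>
    sub_ne_zero.2 fun h => (mem_erase.1 hs).1 (hψ h).symm
  have h2 : (2 : ZMod p) ≠ 0 := fun h => by
    have := (ZMod.natCast_eq_zero_iff 2 p).1 (mod_cast h)
    exact Nat.not_dvd_of_pos_of_lt (by norm_num) (by omega) this
  have hmul : ∏ r ∈ quadResidues p, ∏ s ∈ (quadResidues p).erase r,
      (ψ (2 * r) - ψ (2 * s)) = D := by
    obtain h | h := quadraticChar_dichotomy h2
    · exact prod_prod_erase_quadResidues_dilate (mem_quadResidues.2 h) fun r s => ψ r - ψ s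
    · have h' := prod_prod_erase_quadResidues_dilate ((neg_mem_quadResidues_iff hp).2 h)
        fun r s => ψ (-r) - ψ (-s)
      simp only [neg_mul, neg_neg] at h'
      rw [h']
      have hunit : ∏ r ∈ quadResidues p, ∏ s ∈ (quadResidues p).erase r, ψ r * ψ s = 1 := by
        have hr : ∀ r ∈ quadResidues p, ∏ s ∈ (quadResidues p).erase r, ψ r * ψ s =
            ψ r ^ (#(quadResidues p) - 1) * ∏ s ∈ (quadResidues p).erase r, ψ s := fun r hr => by
          rw [prod_mul_distrib, prod_const, card_erase_of_mem hr]
        have hr' : (∏ r ∈ quadResidues p, ψ r) *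
            ∏ r ∈ quadResidues p, ∏ s ∈ (quadResidues p).erase r, ψ s = 1 := by
          rw [← prod_mul_distrib]
          refine prod_eq_one fun r hr => ?_
          rw [mul_prod_erase _ _ hr, prod_addChar_quadResidues hp3]
        rw [prod_congr rfl hr, prod_mul_distrib, prod_pow]
        rw [prod_addChar_quadResidues hp3] at hr' ⊢
        rw [one_pow, hr']
      rw [← mul_one (∏ r ∈ _, _), ← hunit]
      simp only [← prod_mul_distrib]
      refine prod_congr rfl fun r hr => ?_
      have heven : Even #((quadResidues p).erase r) := by
        rw [card_erase_of_mem hr]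
        exact (odd_card_quadResidues hp).tsub_odd odd_one
      rw [← one_mul (∏ s ∈ _, (ψ r - ψ s)), ← heven.neg_one_pow, ← prod_neg]
      refine prod_congr rfl fun s _ => ?_
      have e : ∀ a, ψ (-a) * ψ a = 1 := fun a => by
        rw [← AddChar.map_add_eq_mul, neg_add_cancel, AddChar.map_zero_eq_one]
      linear_combination ψ s * e r - ψ r * e s
  refine mul_right_cancel₀ hD0 ?_
  rw [one_mul]
  conv_rhs => rw [← hmul]
  rw [hD]
  simp only [← prod_mul_distrib]
  refine prod_congr rfl fun r _ => prod_congr rfl fun s _ => ?_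
  rw [two_mul, two_mul, AddChar.map_add_eq_mul, AddChar.map_add_eq_mul]
  ring

lemma prod_sub_addChar (hp3 : 3 < p) (hp : p % 4 = 3) {ψ : AddChar (ZMod p) ℂ}
    (hψ : Function.Injective ψ) {r : ZMod p} (hr : r ∈ quadResidues p) :
    (ψ r - 1) * (∏ k ∈ (quadResidues p).erase r, (ψ r - ψ k)) * ψ r ^ #(quadResidues p) *
      ∏ k ∈ quadResidues p, (ψ (-r) - ψ k) = -(p * ψ (-r)) := by
  have hr0 := ne_zero_of_mem_quadResidues hr
  have hmul : ψ r * ψ (-r) = 1 := by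
    rw [← AddChar.map_add_eq_mul, add_neg_cancel, AddChar.map_zero_eq_one]
  have hall : ∏ a ∈ {r}ᶜ, (ψ r - ψ a) = p * ψ (-r) := by
    have h1 : ∏ a ∈ {r}ᶜ, (ψ r - ψ a) = ∏ a ∈ {0}ᶜ, (ψ r * (1 - ψ a)) := by
      refine prod_nbij' (· - r) (· + r) ?_ ?_ (fun a _ => sub_add_cancel a r)
        (fun a _ => add_sub_cancel_right a r) ?_
      · intro a ha
        simpa [sub_eq_zero] using ha
      · intro a ha
        simpa using ha
      · intro a _
        rw [mul_sub, ← AddChar.map_add_eq_mul, add_sub_cancel, mul_one]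
    have h2 : ψ r ^ p = 1 := by
      rw [← AddChar.map_nsmul_eq_pow, nsmul_eq_mul, ZMod.natCast_self, zero_mul,
        AddChar.map_zero_eq_one]
    rw [h1, prod_mul_distrib, prod_one_sub_addChar hψ, prod_const, card_compl, card_singleton,
      ZMod.card]
    have h3 := pow_sub_one_mul (Fact.out : p.Prime).ne_zero (ψ r)
    rw [h2] at h3
    linear_combination (p : ℂ) * ψ (-r) * h3 - (p : ℂ) * ψ r ^ (p - 1) * hmul
  have hsplit : ∏ a ∈ {r}ᶜ, (ψ r - ψ a) = (ψ r - 1) *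
      ((∏ k ∈ (quadResidues p).erase r, (ψ r - ψ k)) * ∏ k ∈ quadResidues p, (ψ r - ψ (-k))) := by
    set g : ZMod p → ℂ := fun a => if a = r then 1 else ψ r - ψ a with hg
    have hgr : g r = 1 := by simp [hg]
    have hgne : ∀ a, a ≠ r → g a = ψ r - ψ a := fun a ha => by simp [hg, ha]
    have e1 : ∏ a ∈ {r}ᶜ, (ψ r - ψ a) = ∏ a, g a := by
      rw [Fintype.prod_eq_mul_prod_compl r, hgr, one_mul]
      exact prod_congr rfl fun a ha => (hgne a (by simpa using ha)).symm
    rw [e1, Fintype.prod_eq_mul_prod_compl 0, prod_compl_zero_eq_prod_quadResidues hp,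
      prod_mul_distrib, ← mul_prod_erase _ _ hr, hgr, one_mul, hgne 0 hr0.symm,
      AddChar.map_zero_eq_one]
    congr 2
    · exact prod_congr rfl fun a ha => hgne a (mem_erase.1 ha).1
    · refine prod_congr rfl fun a ha => hgne _ ?_
      rintro rfl
      rw [neg_mem_quadResidues_iff hp, mem_quadResidues.1 ha] at hr
      norm_num at hr
  have hneg : ∏ k ∈ quadResidues p, (ψ r - ψ (-k)) =
      -(ψ r ^ #(quadResidues p) * ∏ k ∈ quadResidues p, (ψ (-r) - ψ k)) := by
    have hk : ∀ k, ψ r - ψ (-k) = -(ψ r * ψ (-k) * (ψ (-r) - ψ k)) := fun k => by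
      have : ψ k * ψ (-k) = 1 := by
        rw [← AddChar.map_add_eq_mul, add_neg_cancel, AddChar.map_zero_eq_one]
      linear_combination -ψ r * this + ψ (-k) * hmul
    have hinv : ∏ k ∈ quadResidues p, ψ (-k) = 1 := by
      simpa using prod_addChar_quadResidues hp3 ψ⁻¹
    rw [prod_congr rfl fun k _ => hk k, prod_neg, (odd_card_quadResidues hp).neg_one_pow,
      prod_mul_distrib, prod_mul_distrib, hinv, prod_const]
    ring
  rw [hneg] at hsplit
  linear_combination -(hsplit.symm.trans hall)

lemma exists_sum_addChar_sub_eq (hp : p % 4 = 3) {ψ : AddChar (ZMod p) ℂ}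
    (hψ : Function.Injective ψ) :
    ∃ τ : ℂ, τ ^ 2 = -(p : ℂ) ∧ ∀ m : ZMod p,
      ∑ r ∈ quadResidues p, (ψ (m * r) - ψ (-(m * r))) = quadraticChar (ZMod p) m * τ := by
  set χ : MulChar (ZMod p) ℂ := (quadraticChar (ZMod p)).ringHomComp (Int.castRingHom ℂ) with hχ
  have h2 : ringChar (ZMod p) ≠ 2 := by
    rw [ZMod.ringChar_zmod_n]
    rintro rfl
    norm_num at hp
  have hχ1 : χ ≠ 1 := by
    rw [hχ, MulChar.ringHomComp_ne_one_iff (RingHom.injective_int _)]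
    exact quadraticChar_ne_one h2
  have hχq : χ.IsQuadratic := (quadraticChar_isQuadratic _).comp _
  have hprim : ψ.IsPrimitive := AddChar.IsPrimitive.of_ne_one fun h =>
    one_ne_zero (hψ (show ψ (1 : ZMod p) = ψ 0 by rw [h]; rfl))
  refine ⟨gaussSum χ ψ, ?_, fun m => ?_⟩
  · rw [gaussSum_sq hχ1 hχq hprim, ZMod.card, hχ, MulChar.ringHomComp_apply,
      quadraticChar_neg_of_mod_four hp]
    simp
  · have hm : gaussSum χ (ψ.mulShift m) = quadraticChar (ZMod p) m * gaussSum χ ψ := by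
      obtain rfl | hm := eq_or_ne m 0
      · rw [AddChar.mulShift_zero, gaussSum_one_right hχ1]
        simp
      · have := gaussSum_mulShift_eq χ ψ (Units.mk0 m hm)
        rw [hχq.inv] at this
        simpa [hχ] using this
    rw [← hm, gaussSum, Fintype.sum_eq_add_sum_compl 0, MulChar.map_zero, zero_mul, zero_add,
      sum_compl_zero_eq_sum_quadResidues hp]
    refine sum_congr rfl fun r hr => ?_
    simp only [hχ, MulChar.ringHomComp_apply, quadraticChar_neg_of_mod_four hp,
      mem_quadResidues.1 hr, AddChar.mulShift_apply, mul_neg]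
    simp [sub_eq_add_neg]

end QuadraticResidues

section LegendreMatrix

open Matrix Finset

variable {p : ℕ} [Fact p.Prime]

/-- The nodes are the squares `y k ^ 2`, where `y k` runs over the `p`-th roots of unity indexed by
the quadratic residues. -/
lemma det_one_add_quadraticChar_sub (hp3 : 3 < p) (hp : p % 4 = 3) {n : ℕ}
    (hn : #(quadResidues p) = n) :
    (of fun i j : Fin n =>
      (1 + quadraticChar (ZMod p) (((j : ℕ) : ZMod p) - ((i : ℕ) : ZMod p)) : ℂ)).det = 1 := by
  have hodd : Odd n := hn ▸ odd_card_quadResidues hp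
  have h2 : (2 : ZMod p) ≠ 0 := fun h => by
    have := (ZMod.natCast_eq_zero_iff 2 p).1 (mod_cast h)
    exact Nat.not_dvd_of_pos_of_lt (by norm_num) (by omega) this
  obtain ⟨ψ, hψ⟩ : ∃ ψ : AddChar (ZMod p) ℂ, Function.Injective ψ :=
    ⟨_, ZMod.injective_stdAddChar⟩
  set φ := ψ.mulShift 2 with hφdef
  have hφapp : ∀ a, φ a = ψ a ^ 2 := fun a => by
    rw [hφdef, AddChar.mulShift_apply, two_mul, AddChar.map_add_eq_mul, sq]
  have hφ : Function.Injective φ := fun a b h => by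
    rw [hφdef, AddChar.mulShift_apply, AddChar.mulShift_apply] at h
    exact mul_left_cancel₀ h2 (hψ h)
  obtain ⟨τ, hτ2, hτ⟩ := exists_sum_addChar_sub_eq hp hφ
  have hτ0 : τ ≠ 0 := by
    rintro rfl
    have := (Fact.out : p.Prime).ne_zero
    simp_all
  set q := ((quadResidues p).equivFinOfCardEq hn).symm
  have hqmem : ∀ k, (q k : ZMod p) ∈ quadResidues p := fun k => (q k).2
  have hqinj : Function.Injective fun k => (q k : ZMod p) :=
    Subtype.val_injective.comp q.injective
  have hprod : ∀ f : ZMod p → ℂ, ∏ k, f (q k) = ∏ r ∈ quadResidues p, f r := fun f =>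
    (q.prod_comp fun r => f r).trans (prod_coe_sort _ f)
  have hsum : ∀ f : ZMod p → ℂ, ∑ k, f (q k) = ∑ r ∈ quadResidues p, f r := fun f =>
    (q.sum_comp fun r => f r).trans (sum_coe_sort _ f)
  have hprod' : ∀ (f : ZMod p → ℂ) k,
      ∏ l ∈ {k}ᶜ, f (q l) = ∏ r ∈ (quadResidues p).erase (q k), f r := fun f k => by
    refine prod_bij (fun l _ => (q l : ZMod p)) ?_ (fun a _ b _ h => hqinj h) ?_ fun _ _ => rfl
    · intro l hl
      exact mem_erase.2 ⟨fun h => (by simpa using hl : l ≠ k) (hqinj h), hqmem l⟩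
    · intro r hr
      rw [mem_erase] at hr
      refine ⟨q.symm ⟨r, hr.2⟩, ?_, by simp⟩
      rw [mem_compl, mem_singleton]
      intro h
      exact hr.1 (by rw [← h]; simp)
  set y : Fin n → ℂ := fun k => ψ (q k) with hy
  set v : Fin n → ℂ := fun k => φ (q k) with hv
  have hvy : ∀ k, v k = y k ^ 2 := fun k => hφapp _
  have hvinv : ∀ k, (v k)⁻¹ = φ (-q k) := fun k => (AddChar.map_neg_eq_inv _ _).symm
  have hyinj : Function.Injective y := hψ.comp hqinj
  have hvinj : Function.Injective v := hφ.comp hqinj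
  have hy0 : ∀ k, y k ≠ 0 := fun k => (ψ.val_isUnit _).ne_zero
  have hyy : ∀ k l, y k * y l ≠ 1 := fun k l h => by
    rw [hy, ← AddChar.map_add_eq_mul, ← ψ.map_zero_eq_one] at h
    have h := hψ h
    have := hqmem k
    rw [eq_neg_of_add_eq_zero_left h, neg_mem_quadResidues_iff hp,
      mem_quadResidues.1 (hqmem l)] at this
    norm_num at this
  have hv1 : ∀ k, 1 - v k ≠ 0 := fun k h => hyy k k (by
    rw [hvy] at h
    linear_combination -h)
  have hvv : ∀ k l, (v k)⁻¹ ≠ v l := fun k l h => by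
    rw [hvinv] at h
    have h := hφ h
    have := hqmem l
    rw [← h, neg_mem_quadResidues_iff hp, mem_quadResidues.1 (hqmem k)] at this
    norm_num at this
  set w : Fin n → ℂ := fun k => Lagrange.nodalWeight univ v k with hw
  have hP1 : (∏ k, (1 - v k)) ^ 2 = τ ^ 2 := by
    rw [hτ2, ← sq_prod_one_sub_addChar hp3 hp hφ, ← hprod fun a => 1 - φ a]
  have hPinv : ∀ k, (∏ l, ((v k)⁻¹ - v l)) * v k * (y k - (y k)⁻¹) = τ ^ 2 * w k := fun k => by
    have h := prod_sub_addChar hp3 hp hφ (hqmem k)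
    rw [← hprod' (fun a => φ (q k) - φ a), ← hprod fun a => φ (-q k) - φ a, ← hvinv, hn] at h
    have hwk : w k * ∏ l ∈ {k}ᶜ, (v k - v l) = 1 := by
      simp only [hw]
      rw [nodalWeight_univ_eq, ← prod_mul_distrib]
      refine prod_eq_one fun l hl => inv_mul_cancel₀ (sub_ne_zero.2 fun h => ?_)
      exact (by simpa using hl : l ≠ k) (hvinj h).symm
    have hyp : v k ^ n * y k = 1 := by
      rw [hvy, ← pow_mul, ← pow_succ, show 2 * n + 1 = p by
        rw [card_quadResidues hp] at hn; omega, hy, ← AddChar.map_nsmul_eq_pow, nsmul_eq_mul,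
        ZMod.natCast_self, zero_mul, AddChar.map_zero_eq_one]
    have e : v k * (v k)⁻¹ = 1 := mul_inv_cancel₀ fun h => by
      rw [hvy] at h
      exact hy0 k (by simpa using h)
    have e' : y k * (y k)⁻¹ = 1 := mul_inv_cancel₀ (hy0 k)
    have e'' : v k ^ n = (y k)⁻¹ := by linear_combination (y k)⁻¹ * hyp - v k ^ n * e'
    change (v k - 1) * (∏ l ∈ {k}ᶜ, (v k - v l)) * v k ^ n * (∏ l, ((v k)⁻¹ - v l)) =
      -(p * (v k)⁻¹) at h
    rw [e''] at h
    rw [hτ2]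
    generalize ∏ l ∈ {k}ᶜ, (v k - v l) = W at h hwk
    generalize ∏ l, ((v k)⁻¹ - v l) = c at h ⊢
    linear_combination -(c * v k * (y k - (y k)⁻¹)) * hwk + w k * v k * h -
      w k * W * c * v k * (y k * e' + (y k)⁻¹ * hvy k) - p * w k * e
  set b : Fin n → ℂ := fun j => (Lagrange.basis univ v j).eval 1 with hb
  set L : Matrix (Fin n) (Fin n) ℂ := of fun i j => (Lagrange.basis univ v j).eval (v i)⁻¹ with hL
  have hfac : (of fun i j : Fin n =>
      (1 + quadraticChar (ZMod p) (((j : ℕ) : ZMod p) - ((i : ℕ) : ZMod p)) : ℂ)) =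
      (vandermonde v)ᵀ * (vecMulVec b b + τ⁻¹ • (Lᵀ - L)) * vandermonde v := by
    have hbV := lagrangeBasis_vecMul_vandermonde hvinj 1
    have hLV := lagrangeBasis_mul_vandermonde hvinj fun i => (v i)⁻¹
    rw [← hb] at hbV
    rw [← hL] at hLV
    have e : (vandermonde v)ᵀ * (vecMulVec b b + τ⁻¹ • (Lᵀ - L)) * vandermonde v =
        vecMulVec (b ᵥ* vandermonde v) (b ᵥ* vandermonde v) +
          τ⁻¹ • ((L * vandermonde v)ᵀ * vandermonde v -
            (vandermonde v)ᵀ * (L * vandermonde v)) := by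
      rw [transpose_mul, ← mulVec_transpose (vandermonde v) b]
      simp only [Matrix.mul_add, Matrix.add_mul, Matrix.mul_smul, Matrix.smul_mul, Matrix.mul_sub,
        Matrix.sub_mul, Matrix.mul_assoc, mul_vecMulVec, vecMulVec_mul, mulVec_transpose]
    rw [e, hbV, hLV]
    ext i j
    have h := hτ (((j : ℕ) : ZMod p) - ((i : ℕ) : ZMod p))
    rw [← hsum fun r => φ ((((j : ℕ) : ZMod p) - ((i : ℕ) : ZMod p)) * r) -
      φ (-((((j : ℕ) : ZMod p) - ((i : ℕ) : ZMod p)) * r))] at h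
    have hpow : ∀ (k : Fin n) (i j : Fin n), ((v k)⁻¹) ^ (i : ℕ) * v k ^ (j : ℕ) =
        φ ((((j : ℕ) : ZMod p) - ((i : ℕ) : ZMod p)) * q k) := fun k i j => by
      rw [hvinv, hv, ← AddChar.map_nsmul_eq_pow, ← AddChar.map_nsmul_eq_pow,
        ← AddChar.map_add_eq_mul, nsmul_eq_mul, nsmul_eq_mul]
      congr 1
      ring
    simp only [Matrix.add_apply, Matrix.smul_apply, Matrix.sub_apply, mul_apply,
      transpose_apply, vandermonde_apply, vecMulVec_apply, one_pow, mul_one, of_apply, smul_eq_mul,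
      ← sum_sub_distrib]
    congr 1
    rw [eq_inv_mul_iff_mul_eq₀ hτ0, mul_comm, ← h]
    refine sum_congr rfl fun k _ => ?_
    rw [hpow k i j, mul_comm (v k ^ (i : ℕ)), hpow k j i]
    congr 2
    ring
  have hB : vecMulVec b b + τ⁻¹ • (Lᵀ - L) = of fun i j => (w i / (1 - v i) * τ) *
      (of fun i j => w j / (1 - v j) *
        (of fun i j => τ + (y i - y j) / (1 - y i * y j)) i j) i j := by
    ext i j
    have hbi : ∀ i, b i = (∏ k, (1 - v k)) * (w i * (1 - v i)⁻¹) := fun i => by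
      rw [hb]
      simp only
      rw [Lagrange.eval_basis_not_at_node (mem_univ i) (sub_ne_zero.1 (hv1 i)),
        Lagrange.eval_nodal]
    have hLij : ∀ i j, L i j = (∏ k, ((v i)⁻¹ - v k)) * (w j * ((v i)⁻¹ - v j)⁻¹) := fun i j => by
      rw [hL, of_apply, Lagrange.eval_basis_not_at_node (mem_univ j) (hvv i j),
        Lagrange.eval_nodal]
    simp only [Matrix.add_apply, Matrix.smul_apply, Matrix.sub_apply, transpose_apply,
      vecMulVec_apply, of_apply, smul_eq_mul]
    have hne : ∀ i, 1 - y i ^ 2 ≠ 0 := fun i => hvy i ▸ hv1 i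
    have hne' : ∀ i j, 1 - y i ^ 2 * y j ^ 2 ≠ 0 := fun i j h => hvv i j <| by
      have := hy0 i
      rw [hvy, hvy]
      field_simp
      linear_combination h
    have hL' : ∀ i j, L i j =
        -(τ ^ 2 * w i * w j * y i / ((1 - y i ^ 2) * (1 - y i ^ 2 * y j ^ 2))) := fun i j => by
      have h := hPinv i
      have a := hne i
      have a' := hne' i j
      have a0 := hy0 i
      rw [hLij]
      generalize ∏ k, ((v i)⁻¹ - v k) = c at h ⊢
      rw [hvy] at h ⊢
      rw [hvy]
      have d : (y i ^ 2)⁻¹ - y j ^ 2 = (1 - y i ^ 2 * y j ^ 2) / y i ^ 2 := by field_simp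
      rw [d, inv_div]
      field_simp at h ⊢
      linear_combination -w j * h
    rw [hbi, hbi, hL', hL']
    generalize ∏ k, (1 - v k) = P at hP1
    rw [hvy, hvy]
    have a := hne i
    have a' := hne j
    have d := hne' i j
    have d' : 1 - y i * y j ≠ 0 := sub_ne_zero.2 (hyy i j).symm
    have e : P * (w i * (1 - y i ^ 2)⁻¹) * (P * (w j * (1 - y j ^ 2)⁻¹)) =
        τ ^ 2 * (w i * (1 - y i ^ 2)⁻¹ * (w j * (1 - y j ^ 2)⁻¹)) := by
      rw [← hP1]
      ring
    rw [e, mul_comm (y j ^ 2) (y i ^ 2)]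
    have d'' : 1 + y i * y j ≠ 0 := fun h => d (by linear_combination (1 - y i * y j) * h)
    have f : 1 - y i ^ 2 * y j ^ 2 = (1 - y i * y j) * (1 + y i * y j) := by ring
    rw [f]
    field_simp
    ring
  have hZ : (∏ i, ∏ j ∈ Ioi i, ((y i + y j) * (1 - y i * y j)) ^ 2) = τ ^ (n - 1) := by
    have e : (∏ i, ∏ j ∈ Ioi i, ((y i + y j) * (1 - y i * y j)) ^ 2) =
        (∏ i, ∏ j ∈ {i}ᶜ, (y i + y j)) * ∏ i, ∏ j ∈ {i}ᶜ, (1 - y i * y j) := by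
      rw [prod_prod_compl_eq_prod_prod_Ioi, prod_prod_compl_eq_prod_prod_Ioi]
      simp only [← prod_mul_distrib]
      refine prod_congr rfl fun i _ => prod_congr rfl fun j _ => ?_
      ring
    rw [e]
    simp only [hy, ← AddChar.map_add_eq_mul]
    rw [prod_congr rfl fun i _ => hprod' (fun r => ψ (q i) + ψ r) i,
      hprod fun r => ∏ s ∈ (quadResidues p).erase r, (ψ r + ψ s),
      prod_prod_addChar_add hp3 hp hψ,
      prod_congr rfl fun i _ => hprod' (fun r => 1 - ψ (q i + r)) i,
      hprod fun r => ∏ s ∈ (quadResidues p).erase r, (1 - ψ (r + s)),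
      prod_prod_one_sub_addChar_add hp3 hp, one_mul, hn]
    obtain ⟨m, hm⟩ := hodd
    rw [show n - 1 = 2 * m by omega, pow_mul, pow_mul, sq_prod_one_sub_addChar hp3 hp hψ, hτ2]
  have hVZ : (vandermonde v).det ^ 2 * (∏ i, w i) ^ 2 *
      (∏ i, ∏ j ∈ Ioi i, ((y i - y j) / (1 - y i * y j)) ^ 2) *
      (∏ i, ∏ j ∈ Ioi i, ((y i + y j) * (1 - y i * y j)) ^ 2) = 1 := by
    simp only [hw, nodalWeight_univ_eq]
    rw [prod_prod_compl_eq_prod_prod_Ioi, det_vandermonde]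
    simp only [← prod_mul_distrib, ← prod_pow]
    refine prod_eq_one fun i _ => prod_eq_one fun j hj => ?_
    have hne : v i - v j ≠ 0 := sub_ne_zero.2 (hvinj.ne (mem_Ioi.1 hj).ne)
    have hne' : v j - v i ≠ 0 := sub_ne_zero.2 (hvinj.ne (mem_Ioi.1 hj).ne')
    have h1 : 1 - y i * y j ≠ 0 := sub_ne_zero.2 (hyy i j).symm
    have e : ((y i - y j) / (1 - y i * y j)) ^ 2 * ((y i + y j) * (1 - y i * y j)) ^ 2 =
        (v i - v j) ^ 2 := by
      rw [hvy, hvy]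
      field_simp
      ring
    rw [mul_assoc, e]
    field_simp
  have hP0 : (∏ k, (1 - v k)) ≠ 0 := prod_ne_zero_iff.2 fun k _ => hv1 k
  rw [hfac, det_mul, det_mul, det_transpose, hB, det_mul_column, det_mul_row,
    det_const_add_schur hodd hyinj hy0 fun i j => sub_ne_zero.2 (hyy i j).symm,
    prod_mul_distrib, prod_div_distrib, prod_const, card_univ, Fintype.card_fin]
  rw [hZ] at hVZ
  have hτn : τ ^ (n - 1) * τ = τ ^ n := pow_sub_one_mul hodd.pos.ne' τ
  generalize ∏ k, (1 - v k) = P at hP1 hP0 ⊢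
  generalize ∏ i, ∏ j ∈ Ioi i, ((y i - y j) / (1 - y i * y j)) ^ 2 = Z at hVZ ⊢
  rw [← hτn]
  field_simp
  rw [hP1]
  linear_combination τ ^ 2 * hVZ

end LegendreMatrix

/-- Let `p > 3` be a prime with `p ≡ 3 (mod 4)`. Then
`det [1 + ((j-i)/p)]_{1 ≤ i,j ≤ (p-1)/2} = 1`. -/
theorem stmt7 (p : ℕ) [Fact p.Prime] (hp3 : 3 < p) (hp : p % 4 = 3) :
    (Matrix.of fun i j : Fin ((p - 1) / 2) =>
        1 + legendreSym p ((((j : ℕ) : ℤ) + 1) - (((i : ℕ) : ℤ) + 1))).det = 1 := by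
  have h := det_one_add_quadraticChar_sub hp3 hp (card_quadResidues hp)
  apply (Int.castRingHom ℂ).injective_int
  rw [RingHom.map_det, map_one, ← h]
  congr 1
  ext i j
  simp [legendreSym]
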